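/- Let 𝓔^d be the qubit completely dephasing channel 𝓔^d(A) = |0⟩⟨0|A|0⟩⟨0| + |1⟩⟨1|A|1⟩⟨1| acting on the bath qubit, let H = Z⊗Z ∈ B(ℂ₁²⊗ℂ₂²), 𝓗 = [H,·], and let 𝓔_DD = ((𝓘₁⊗𝓔^d) ∘ e^{−i(t/n)𝓗})^n for any n ≥ 1 and t ∈ ℝ. Then for any density operator ρ₁ ∈ T(ℂ₁²) and the bath state ρ₂ = p|0⟩⟨0| + (1−p)|1⟩⟨1| with p ∈ (0,1), 𝓔_DD(ρ₁⊗ρ₂) = p · e^{−itZ}ρ₁e^{itZ} ⊗ |0⟩⟨0| + (1−p) · e^{itZ}ρ₁e^{−itZ} ⊗ |1⟩⟨1|; i.e. the decoupling evolution develops a classical correlation between system and bath whenever [Z, ρ₁] ≠ 0. -/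

import Mathlib

open Matrix Kronecker
open scoped ComplexOrder
noncomputable section

abbrev MatC (n : ℕ) := Matrix (Fin n) (Fin n) ℂ

/-- The Choi-Jamiołkowski matrix of a linear map on matrices. -/
def choi {n : ℕ} (E : MatC n →ₗ[ℂ] MatC n) : Matrix (Fin n × Fin n) (Fin n × Fin n) ℂ :=
  fun p q => E (Matrix.single p.2 q.2 1) p.1 q.1

/-- A quantum channel: a completely positive (equivalently, with positive semidefinite
Choi matrix) and trace-preserving linear map. -/
def IsQuantumChannel {n : ℕ} (E : MatC n →ₗ[ℂ] MatC n) : Prop :=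
  (choi E).PosSemidef ∧ ∀ A : MatC n, (E A).trace = A.trace

/-- A channel is ergodic when its fixed-point space is one-dimensional. -/
def IsErgodic {n : ℕ} (E : MatC n →ₗ[ℂ] MatC n) : Prop :=
  Module.finrank ℂ (Module.End.eigenspace E 1) = 1


abbrev MatC2 (d₁ d₂ : ℕ) := Matrix (Fin d₁ × Fin d₂) (Fin d₁ × Fin d₂) ℂ

/-- The map `𝓘₁ ⊗ 𝓔` on operators of a bipartite system, acting as `𝓔` on the second factor. -/
def idTensor {d₁ d₂ : ℕ} (E : MatC d₂ →ₗ[ℂ] MatC d₂) : MatC2 d₁ d₂ →ₗ[ℂ] MatC2 d₁ d₂ where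
  toFun M := Matrix.of fun p q => E (Matrix.of fun a b => M (p.1, a) (q.1, b)) p.2 q.2
  map_add' M N := by
    ext p q
    have h : (Matrix.of fun a b => (M + N) (p.1, a) (q.1, b)) =
        (Matrix.of fun a b => M (p.1, a) (q.1, b)) +
          (Matrix.of fun a b => N (p.1, a) (q.1, b)) := rfl
    show E (Matrix.of fun a b => (M + N) (p.1, a) (q.1, b)) p.2 q.2 = _
    rw [h, map_add]
    rfl
  map_smul' c M := by
    ext p q
    have h : (Matrix.of fun a b => (c • M) (p.1, a) (q.1, b)) =
        c • (Matrix.of fun a b => M (p.1, a) (q.1, b)) := rfl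
    show E (Matrix.of fun a b => (c • M) (p.1, a) (q.1, b)) p.2 q.2 = _
    rw [h, _root_.map_smul]
    rfl

/-- The conjugation map `A ↦ E * A * F`. -/
def conjMap {n : ℕ} (E F : MatC n) : MatC n →ₗ[ℂ] MatC n where
  toFun A := E * A * F
  map_add' A B := by noncomm_ring
  map_smul' c A := by
    simp [Matrix.mul_smul, Matrix.smul_mul]

/-- The completely dephasing channel `𝓔ᵈ(A) = Σᵢ |i⟩⟨i| A |i⟩⟨i|`. -/
def dephasing (d : ℕ) : MatC d →ₗ[ℂ] MatC d :=
  ∑ i : Fin d, conjMap (Matrix.single i i 1) (Matrix.single i i 1)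

/-- The conjugation map `A ↦ E * A * F` on two-qubit operators. -/
def conjMap2 (E F : MatC2 2 2) : MatC2 2 2 →ₗ[ℂ] MatC2 2 2 where
  toFun A := E * A * F
  map_add' A B := by noncomm_ring
  map_smul' c A := by
    simp [Matrix.mul_smul, Matrix.smul_mul]

/-- The Pauli matrix `Z = |0⟩⟨0| - |1⟩⟨1|`. -/
def PauliZ : MatC 2 :=
  Matrix.single 0 0 1 - Matrix.single 1 1 1

/-- `e^{isZ}` for `s ∈ ℝ`. -/
def expItZ (s : ℝ) : MatC 2 :=
  NormedSpace.exp (((s : ℂ) * Complex.I) • PauliZ)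

/-- `e^{is(Z⊗Z)}` for `s ∈ ℝ`. -/
def expItZZ (s : ℝ) : MatC2 2 2 :=
  NormedSpace.exp (((s : ℂ) * Complex.I) • (PauliZ ⊗ₖ PauliZ))

/-- The eigenvalues of `Z`. -/
def zv (i : Fin 2) : ℂ := if i = 0 then 1 else -1

lemma PauliZ_diag : PauliZ = Matrix.diagonal zv := by
  ext i j
  fin_cases i <;> fin_cases j <;> simp [PauliZ, zv, Matrix.single]

lemma expItZ_diag (s : ℝ) :
    expItZ s = Matrix.diagonal (fun i => Complex.exp ((s : ℂ) * Complex.I * zv i)) := by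
  rw [expItZ, PauliZ_diag, ← Matrix.diagonal_smul, Matrix.exp_diagonal]
  congr 1
  ext i
  simp [Pi.coe_exp, Complex.exp_eq_exp_ℂ]

lemma expItZZ_diag (s : ℝ) :
    expItZZ s = Matrix.diagonal
      (fun i => Complex.exp ((s : ℂ) * Complex.I * (zv i.1 * zv i.2))) := by
  rw [expItZZ, PauliZ_diag, Matrix.diagonal_kronecker_diagonal, ← Matrix.diagonal_smul,
    Matrix.exp_diagonal]
  congr 1
  ext i
  simp [Pi.coe_exp, Complex.exp_eq_exp_ℂ]

lemma dephasing_apply (M : MatC 2) (i j : Fin 2) :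
    dephasing 2 M i j = if i = j then M i j else 0 := by
  fin_cases i <;> fin_cases j <;>
    simp [dephasing, conjMap, Fin.sum_univ_two, Matrix.mul_apply, Matrix.single]

lemma step_apply (s : ℝ) (M : MatC2 2 2) (a b : Fin 2 × Fin 2) :
    (idTensor (dephasing 2) ∘ₗ conjMap2 (expItZZ (-s)) (expItZZ s)) M a b
      = if a.2 = b.2 then
          Complex.exp ((s : ℂ) * Complex.I * (zv b.1 * zv b.2 - zv a.1 * zv a.2)) * M a b
        else 0 := by
  show dephasing 2 (Matrix.of fun x y =>
    (expItZZ (-s) * M * expItZZ s) (a.1, x) (b.1, y)) a.2 b.2 = _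
  rw [dephasing_apply]
  split_ifs
  · rw [Matrix.of_apply, expItZZ_diag, expItZZ_diag, Matrix.mul_diagonal, Matrix.diagonal_mul,
      mul_right_comm, ← Complex.exp_add]
    congr 2
    push_cast
    ring
  · rfl

lemma ddStep_pow_apply (s : ℝ) (M : MatC2 2 2) (hM : ∀ a b, a.2 ≠ b.2 → M a b = 0) (k : ℕ)
    (a b : Fin 2 × Fin 2) :
    ((idTensor (dephasing 2) ∘ₗ conjMap2 (expItZZ (-s)) (expItZZ s)) ^ k) M a b
      = Complex.exp ((k : ℂ) * s * Complex.I * (zv b.1 * zv b.2 - zv a.1 * zv a.2)) * M a b := by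
  induction k generalizing a b with
  | zero => simp
  | succ k ih =>
    rw [pow_succ', Module.End.mul_apply, step_apply, ih]
    split_ifs with h
    · rw [← mul_assoc, ← Complex.exp_add]
      congr 2
      push_cast
      ring
    · rw [hM a b h, mul_zero]

/-- **The dephasing bath kicks develop classical correlations.**
For `H = Z⊗Z`, the decoupling evolution `𝓔_DD = ((𝓘₁⊗𝓔ᵈ) e^{−i(t/n)𝓗})ⁿ` maps the product
state `ρ₁ ⊗ (p|0⟩⟨0| + (1−p)|1⟩⟨1|)` to
`p e^{−itZ}ρ₁e^{itZ} ⊗ |0⟩⟨0| + (1−p) e^{itZ}ρ₁e^{−itZ} ⊗ |1⟩⟨1|`,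
a classically correlated system-bath state whenever `[Z, ρ₁] ≠ 0`. -/
theorem dephasing_bath_DD_classical_correlation (n : ℕ) (hn : 1 ≤ n) (t : ℝ)
    (ρ₁ : MatC 2) (hρ₁ : ρ₁.PosSemidef) (hρ₁tr : ρ₁.trace = 1)
    (p : ℝ) (hp0 : 0 < p) (hp1 : p < 1) :
    (((idTensor (dephasing 2)) ∘ₗ conjMap2 (expItZZ (-(t / n))) (expItZZ (t / n))) ^ n)
        (ρ₁ ⊗ₖ ((p : ℂ) • Matrix.single 0 0 1
          + ((1 - p : ℝ) : ℂ) • Matrix.single 1 1 1))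
      = (p : ℂ) • ((expItZ (-t) * ρ₁ * expItZ t) ⊗ₖ Matrix.single 0 0 1)
        + ((1 - p : ℝ) : ℂ) • ((expItZ t * ρ₁ * expItZ (-t)) ⊗ₖ Matrix.single 1 1 1) := by
  have hn' : (n : ℂ) ≠ 0 := by
    have : n ≠ 0 := by omega
    exact_mod_cast this
  have hs : (n : ℂ) * ((t / n : ℝ) : ℂ) = t := by
    push_cast
    field_simp
  ext ⟨a1, a2⟩ ⟨b1, b2⟩
  rw [ddStep_pow_apply, hs]
  · simp only [expItZ_diag, Matrix.add_apply, Matrix.smul_apply, Matrix.kroneckerMap_apply,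
      Matrix.mul_diagonal, Matrix.diagonal_mul, smul_eq_mul]
    have e1 : Complex.exp (((-t : ℝ) : ℂ) * Complex.I * zv a1) * ρ₁ a1 b1 *
        Complex.exp ((t : ℂ) * Complex.I * zv b1)
        = Complex.exp ((t : ℂ) * Complex.I * (zv b1 - zv a1)) * ρ₁ a1 b1 := by
      rw [mul_right_comm, ← Complex.exp_add]
      congr 2
      push_cast
      ring
    have e2 : Complex.exp ((t : ℂ) * Complex.I * zv a1) * ρ₁ a1 b1 *
        Complex.exp (((-t : ℝ) : ℂ) * Complex.I * zv b1)
        = Complex.exp ((t : ℂ) * Complex.I * (zv a1 - zv b1)) * ρ₁ a1 b1 := by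
      rw [mul_right_comm, ← Complex.exp_add]
      congr 2
      push_cast
      ring
    rw [e1, e2]
    have e3 : zv b1 * -1 - zv a1 * -1 = zv a1 - zv b1 := by ring
    have z0 : zv 0 = 1 := by simp [zv]
    have z1 : zv 1 = -1 := by simp [zv]
    fin_cases a2 <;> fin_cases b2 <;>
      simp only [Fin.zero_eta, Fin.mk_one, Matrix.single_apply, z0, z1, e3, mul_one] <;>
      simp <;> ring
  · rintro ⟨a1, a2⟩ ⟨b1, b2⟩ h
    fin_cases a2 <;> fin_cases b2 <;> simp [Matrix.single] at h ⊢
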